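/- Let N ∈ ℕ, 0 < k₁ < ⋯ < k_N, γ₁, …, γ_N ∈ ℝ, and set θᵢ(t,x) = kᵢ(x − 4kᵢ²t − γᵢ) and C_N(t,x) = [ (kᵢ + kⱼ)^{−1} e^{−(θᵢ(t,x) + θⱼ(t,x))} ]_{1≤i,j≤N}. Then det(I + C_N(t,x)) > 0 for all (t,x) ∈ ℝ², and the function φ_N(t,x) = ∂_x² log det(I + C_N(t,x)) is a smooth solution of the KdV equation ∂_t u + ∂_x(∂_x² u + 6u²) = 0 on ℝ × ℝ. -/

import Mathlib

open scoped BigOperators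

noncomputable section

/-- the phases `θᵢ(t,x) = kᵢ (x − 4kᵢ² t − γᵢ)` -/
def thetaK (N : ℕ) (k γ : Fin N → ℝ) (t x : ℝ) (i : Fin N) : ℝ :=
  k i * (x - 4 * k i ^ 2 * t - γ i)

/-- the matrix `C_N(t,x) = [e^{−(θᵢ+θⱼ)}/(kᵢ+kⱼ)]` -/
def CN (N : ℕ) (k γ : Fin N → ℝ) (t x : ℝ) : Matrix (Fin N) (Fin N) ℝ :=
  Matrix.of fun i j =>
    (k i + k j)⁻¹ * Real.exp (-(thetaK N k γ t x i + thetaK N k γ t x j))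

/-- the `N`-soliton profile `φ_N = ∂ₓ² log det(I + C_N)` -/
def phiN (N : ℕ) (k γ : Fin N → ℝ) (t x : ℝ) : ℝ :=
  deriv (fun y => deriv (fun z => Real.log ((1 + CN N k γ t z).det)) y) x


section helpers

open Matrix

variable {N : ℕ}

/-- weighted exponential vectors `k_i^a e^{-θ_i}` -/
def evec (N : ℕ) (k γ : Fin N → ℝ) (a : ℕ) (t x : ℝ) (i : Fin N) : ℝ :=
  k i ^ a * Real.exp (-(thetaK N k γ t x i))

/-- the moments `⟨K^a e, (1+C)⁻¹ K^b e⟩` -/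
def mom (N : ℕ) (k γ : Fin N → ℝ) (a b : ℕ) (t x : ℝ) : ℝ :=
  evec N k γ a t x ⬝ᵥ ((1 + CN N k γ t x)⁻¹ *ᵥ evec N k γ b t x)

lemma evec_hasDerivAt_x (k γ : Fin N → ℝ) (a : ℕ) (t x : ℝ) (i : Fin N) :
    HasDerivAt (fun y => evec N k γ a t y i) (-(evec N k γ (a+1) t x i)) x := by
  unfold evec thetaK
  have h1 : HasDerivAt (fun y : ℝ => -(k i * (y - 4 * k i ^ 2 * t - γ i))) (-(k i * 1)) x :=
    ((((hasDerivAt_id x).sub_const _).sub_const _).const_mul (k i)).neg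
  exact (h1.exp.const_mul (k i ^ a)).congr_deriv (by ring)

lemma evec_hasDerivAt_t (k γ : Fin N → ℝ) (a : ℕ) (t x : ℝ) (i : Fin N) :
    HasDerivAt (fun s => evec N k γ a s x i) (4 * (evec N k γ (a+3) t x i)) t := by
  unfold evec thetaK
  have h1 : HasDerivAt (fun s : ℝ => -(k i * (x - 4 * k i ^ 2 * s - γ i)))
      (-(k i * (-(4 * k i ^ 2 * 1)))) t :=
    (((((hasDerivAt_id t).const_mul (4 * k i ^ 2)).const_sub x).sub_const _).const_mul (k i)).neg
  exact (h1.exp.const_mul (k i ^ a)).congr_deriv (by ring)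

lemma CN_apply (k γ : Fin N → ℝ) (t x : ℝ) (i j : Fin N) :
    CN N k γ t x i j = (k i + k j)⁻¹ * (evec N k γ 0 t x i * evec N k γ 0 t x j) := by
  simp only [CN, evec, Matrix.of_apply, neg_add, Real.exp_add, pow_zero, one_mul]

lemma evec_mul (k γ : Fin N → ℝ) (a : ℕ) (t x : ℝ) (i : Fin N) :
    evec N k γ a t x i = k i ^ a * evec N k γ 0 t x i := by
  simp [evec]

/-- `∂ₓ C` -/
def Cx (N : ℕ) (k γ : Fin N → ℝ) (t x : ℝ) : Matrix (Fin N) (Fin N) ℝ :=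
  -(vecMulVec (evec N k γ 0 t x) (evec N k γ 0 t x))

/-- `∂ₜ C` -/
def Ct (N : ℕ) (k γ : Fin N → ℝ) (t x : ℝ) : Matrix (Fin N) (Fin N) ℝ :=
  (4:ℝ) • (vecMulVec (evec N k γ 2 t x) (evec N k γ 0 t x)
    - vecMulVec (evec N k γ 1 t x) (evec N k γ 1 t x)
    + vecMulVec (evec N k γ 0 t x) (evec N k γ 2 t x))

lemma CN_hasDerivAt_x (k : Fin N → ℝ) (hk : ∀ i, 0 < k i) (γ : Fin N → ℝ) (t x : ℝ)
    (i j : Fin N) :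
    HasDerivAt (fun y => (1 + CN N k γ t y) i j) (Cx N k γ t x i j) x := by
  have hne : k i + k j ≠ 0 := (add_pos (hk i) (hk j)).ne'
  simp only [Matrix.add_apply, CN_apply]
  have := (((evec_hasDerivAt_x k γ 0 t x i).fun_mul
    (evec_hasDerivAt_x k γ 0 t x j)).const_mul ((k i + k j)⁻¹)).const_add
      ((1 : Matrix (Fin N) (Fin N) ℝ) i j)
  refine this.congr_deriv ?_
  simp only [Cx, Matrix.neg_apply, vecMulVec_apply]
  rw [evec_mul k γ (0+1) t x i, evec_mul k γ (0+1) t x j]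
  field_simp
  ring

lemma CN_hasDerivAt_t (k : Fin N → ℝ) (hk : ∀ i, 0 < k i) (γ : Fin N → ℝ) (t x : ℝ)
    (i j : Fin N) :
    HasDerivAt (fun s => (1 + CN N k γ s x) i j) (Ct N k γ t x i j) t := by
  have hne : k i + k j ≠ 0 := (add_pos (hk i) (hk j)).ne'
  simp only [Matrix.add_apply, CN_apply]
  have := (((evec_hasDerivAt_t k γ 0 t x i).fun_mul
    (evec_hasDerivAt_t k γ 0 t x j)).const_mul ((k i + k j)⁻¹)).const_add
      ((1 : Matrix (Fin N) (Fin N) ℝ) i j)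
  refine this.congr_deriv ?_
  simp only [Ct, Matrix.smul_apply, Matrix.add_apply, Matrix.sub_apply, vecMulVec_apply,
    smul_eq_mul]
  rw [evec_mul k γ (0+3) t x i, evec_mul k γ (0+3) t x j, evec_mul k γ 2 t x i,
    evec_mul k γ 2 t x j, evec_mul k γ 1 t x i, evec_mul k γ 1 t x j]
  field_simp
  ring

/-! ### positivity -/

lemma CN_quad_nonneg (k : Fin N → ℝ) (hk : ∀ i, 0 < k i) (γ : Fin N → ℝ) (t x : ℝ)
    (z : Fin N → ℝ) : 0 ≤ z ⬝ᵥ ((CN N k γ t x) *ᵥ z) := by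
  have hd : ∀ y, HasDerivAt (fun y => z ⬝ᵥ ((CN N k γ t y) *ᵥ z))
      (-(∑ i, evec N k γ 0 t y i * z i) ^ 2) y := by
    intro y
    simp only [dotProduct, mulVec]
    have : HasDerivAt (fun y => ∑ i, z i * ∑ j, CN N k γ t y i j * z j)
        (∑ i, z i * ∑ j, Cx N k γ t y i j * z j) y := by
      refine HasDerivAt.fun_sum fun i _ => ?_
      refine HasDerivAt.const_mul _ ?_
      refine HasDerivAt.fun_sum fun j _ => ?_
      refine HasDerivAt.mul_const ?_ _
      have := (CN_hasDerivAt_x k hk γ t y i j).sub_const ((1 : Matrix (Fin N) (Fin N) ℝ) i j)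
      simpa [Matrix.add_apply] using this
    refine this.congr_deriv ?_
    rw [sq, Finset.sum_mul_sum, ← Finset.sum_neg_distrib]
    refine Finset.sum_congr rfl fun i _ => ?_
    rw [Finset.mul_sum, ← Finset.sum_neg_distrib]
    refine Finset.sum_congr rfl fun j _ => ?_
    simp only [Cx, Matrix.neg_apply, vecMulVec_apply]
    ring
  have hanti : Antitone (fun y => z ⬝ᵥ ((CN N k γ t y) *ᵥ z)) := by
    refine antitone_of_deriv_nonpos (fun y => (hd y).differentiableAt) fun y => ?_
    rw [(hd y).deriv]
    nlinarith [sq_nonneg (∑ i, evec N k γ 0 t y i * z i)]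
  have he : ∀ i, Filter.Tendsto (fun y => evec N k γ 0 t y i) Filter.atTop (nhds 0) := by
    intro i
    simp only [evec, thetaK, pow_zero, one_mul]
    refine Real.tendsto_exp_neg_atTop_nhds_zero.comp ?_
    refine Filter.Tendsto.const_mul_atTop (hk i) ?_
    simp only [sub_eq_add_neg]
    exact Filter.tendsto_atTop_add_const_right _ _
      (Filter.tendsto_atTop_add_const_right _ _ Filter.tendsto_id)
  have hlim : Filter.Tendsto (fun y => z ⬝ᵥ ((CN N k γ t y) *ᵥ z)) Filter.atTop (nhds 0) := by
    simp only [dotProduct, mulVec, CN_apply]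
    have : Filter.Tendsto (fun y => ∑ i, z i * ∑ j, (k i + k j)⁻¹ *
        (evec N k γ 0 t y i * evec N k γ 0 t y j) * z j) Filter.atTop
        (nhds (∑ i, z i * ∑ j, (k i + k j)⁻¹ * (0 * 0) * z j)) := by
      refine tendsto_finsetSum _ fun i _ => Filter.Tendsto.const_mul _ ?_
      refine tendsto_finsetSum _ fun j _ => Filter.Tendsto.mul_const _ ?_
      exact ((he i).mul (he j)).const_mul _
    simpa using this
  exact hanti.le_of_tendsto hlim x

lemma CN_det_pos (k : Fin N → ℝ) (hk : ∀ i, 0 < k i) (γ : Fin N → ℝ) (t x : ℝ) :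
    0 < (1 + CN N k γ t x).det := by
  have hC : (CN N k γ t x).PosSemidef := by
    refine Matrix.PosSemidef.of_dotProduct_mulVec_nonneg ?_ ?_
    · ext i j
      simp only [conjTranspose_apply, star_trivial, CN_apply]
      rw [add_comm (k j)]; ring
    · intro z
      simpa using CN_quad_nonneg k hk γ t x z
  exact (Matrix.PosDef.one.add_posSemidef hC).det_pos

lemma CN_isUnit (k : Fin N → ℝ) (hk : ∀ i, 0 < k i) (γ : Fin N → ℝ) (t x : ℝ) :
    IsUnit (1 + CN N k γ t x).det := (CN_det_pos k hk γ t x).ne'.isUnit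

/-! ### smoothness -/

lemma contDiff_det {E : Type*} [NormedAddCommGroup E] [NormedSpace ℝ E]
    {n : WithTop ℕ∞} (M : E → Matrix (Fin N) (Fin N) ℝ)
    (h : ∀ i j, ContDiff ℝ n fun p => M p i j) : ContDiff ℝ n fun p => (M p).det := by
  simp only [Matrix.det_apply]
  refine ContDiff.sum fun σ _ => ?_
  refine ContDiff.const_smul _ ?_
  exact contDiff_prod fun i _ => h _ _

lemma contDiff_inv {E : Type*} [NormedAddCommGroup E] [NormedSpace ℝ E]
    {n : WithTop ℕ∞} (M : E → Matrix (Fin N) (Fin N) ℝ)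
    (h : ∀ i j, ContDiff ℝ n fun p => M p i j) (h0 : ∀ p, (M p).det ≠ 0) (i j : Fin N) :
    ContDiff ℝ n fun p => (M p)⁻¹ i j := by
  simp only [Matrix.inv_def, Matrix.smul_apply, smul_eq_mul, Ring.inverse_eq_inv',
    Matrix.adjugate_apply]
  refine ContDiff.mul ((contDiff_det M h).inv h0) ?_
  refine contDiff_det _ fun a b => ?_
  by_cases hab : a = j
  · subst hab
    simp only [Matrix.updateRow_self]
    exact contDiff_const
  · simp only [Matrix.updateRow_ne hab]
    exact h a b

/-- differentiability of the determinant along a differentiable family -/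
lemma differentiableAt_det {x : ℝ} (M : ℝ → Matrix (Fin N) (Fin N) ℝ)
    (h : ∀ i j, DifferentiableAt ℝ (fun p => M p i j) x) :
    DifferentiableAt ℝ (fun p => (M p).det) x := by
  simp only [Matrix.det_apply]
  fun_prop

lemma evec_contDiff (k γ : Fin N → ℝ) (a : ℕ) (i : Fin N) {n : WithTop ℕ∞} :
    ContDiff ℝ n fun p : ℝ × ℝ => evec N k γ a p.1 p.2 i := by
  unfold evec thetaK
  fun_prop

lemma CN_contDiff (k γ : Fin N → ℝ) (i j : Fin N) {n : WithTop ℕ∞} :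
    ContDiff ℝ n fun p : ℝ × ℝ => (1 + CN N k γ p.1 p.2) i j := by
  simp only [Matrix.add_apply, CN_apply]
  have h1 := evec_contDiff k γ 0 i (n := n)
  have h2 := evec_contDiff k γ 0 j (n := n)
  fun_prop

lemma inv_contDiff (k : Fin N → ℝ) (hk : ∀ i, 0 < k i) (γ : Fin N → ℝ) (i j : Fin N)
    {n : WithTop ℕ∞} :
    ContDiff ℝ n fun p : ℝ × ℝ => (1 + CN N k γ p.1 p.2)⁻¹ i j :=
  contDiff_inv (fun p : ℝ × ℝ => 1 + CN N k γ p.1 p.2) (fun i j => CN_contDiff k γ i j)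
    (fun p => (CN_det_pos k hk γ p.1 p.2).ne') i j

lemma mom_contDiff (k : Fin N → ℝ) (hk : ∀ i, 0 < k i) (γ : Fin N → ℝ) (a b : ℕ)
    {n : WithTop ℕ∞} :
    ContDiff ℝ n fun p : ℝ × ℝ => mom N k γ a b p.1 p.2 := by
  simp only [mom, dotProduct, mulVec]
  refine ContDiff.sum fun i _ => (evec_contDiff k γ a i).mul ?_
  exact ContDiff.sum fun j _ => (inv_contDiff k hk γ i j).mul (evec_contDiff k γ b j)

/-! ### derivative of the inverse and of the determinant -/

lemma inv_hasDerivAt {x : ℝ} (M : ℝ → Matrix (Fin N) (Fin N) ℝ) (M' : Matrix (Fin N) (Fin N) ℝ)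
    (h : ∀ i j, HasDerivAt (fun p => M p i j) (M' i j) x)
    (h0 : ∀ p, IsUnit (M p).det)
    (hd : ∀ i j, DifferentiableAt ℝ (fun p => (M p)⁻¹ i j) x) (i j : Fin N) :
    HasDerivAt (fun p => (M p)⁻¹ i j) ((-((M x)⁻¹ * M' * (M x)⁻¹)) i j) x := by
  let G' : Matrix (Fin N) (Fin N) ℝ := Matrix.of fun i j => deriv (fun p => (M p)⁻¹ i j) x
  have hG : ∀ i j, HasDerivAt (fun p => (M p)⁻¹ i j) (G' i j) x := fun i j => (hd i j).hasDerivAt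
  have key : G' * M x + (M x)⁻¹ * M' = 0 := by
    ext a b
    have h1 : HasDerivAt (fun p => ((M p)⁻¹ * M p) a b)
        ((G' * M x + (M x)⁻¹ * M') a b) x := by
      simp only [Matrix.mul_apply, Matrix.add_apply, ← Finset.sum_add_distrib]
      exact HasDerivAt.fun_sum fun c _ => (hG a c).fun_mul (h c b)
    have h2 : (fun p => ((M p)⁻¹ * M p) a b) = fun _ => (1 : Matrix (Fin N) (Fin N) ℝ) a b := by
      funext p
      rw [Matrix.nonsing_inv_mul _ (h0 p)]
    rw [h2] at h1
    simpa using h1.unique (hasDerivAt_const _ _)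
  have : G' = -((M x)⁻¹ * M' * (M x)⁻¹) := by
    have h3 : G' * M x = -((M x)⁻¹ * M') := eq_neg_of_add_eq_zero_left key
    calc G' = G' * M x * (M x)⁻¹ := by
          rw [Matrix.mul_assoc, Matrix.mul_nonsing_inv _ (h0 x), Matrix.mul_one]
      _ = _ := by rw [h3, Matrix.neg_mul]
  rw [← this]
  exact hG i j

lemma det_hasDerivAt {x : ℝ} (M : ℝ → Matrix (Fin N) (Fin N) ℝ) (M' : Matrix (Fin N) (Fin N) ℝ)
    (h : ∀ i j, HasDerivAt (fun p => M p i j) (M' i j) x)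
    (h0 : IsUnit (M x).det) :
    HasDerivAt (fun p => (M p).det) ((M x).det * ((M x)⁻¹ * M').trace) x := by
  let D : (Fin N → Fin N → ℝ) → ℝ := fun A => (Matrix.of A).det
  have hD : ContDiff ℝ 1 D := by
    refine contDiff_det (E := Fin N → Fin N → ℝ) (fun A => Matrix.of A) fun i j => ?_
    simp only [Matrix.of_apply]
    fun_prop
  have hDf : HasFDerivAt D (fderiv ℝ D (fun i j => M x i j)) (fun i j => M x i j) :=
    (hD.differentiable (by norm_num) _).hasFDerivAt
  have hM : HasDerivAt (fun p => (fun i j => M p i j : Fin N → Fin N → ℝ))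
      (fun i j => M' i j) x :=
    hasDerivAt_pi.2 fun i => hasDerivAt_pi.2 fun j => h i j
  have hc : HasDerivAt (fun p => (M p).det) (fderiv ℝ D (fun i j => M x i j) (fun i j => M' i j)) x :=
    hDf.comp_hasDerivAt x hM
  -- along the line
  have hL : HasDerivAt (fun r : ℝ => (fun i j => M x i j + r * M' i j : Fin N → Fin N → ℝ))
      (fun i j => M' i j) 0 := by
    refine hasDerivAt_pi.2 fun i => hasDerivAt_pi.2 fun j => ?_
    simpa using ((hasDerivAt_id (0:ℝ)).mul_const (M' i j)).const_add (M x i j)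
  have hDf' : HasFDerivAt D (fderiv ℝ D (fun i j => M x i j))
      ((fun r : ℝ => (fun i j => M x i j + r * M' i j : Fin N → Fin N → ℝ)) 0) := by
    simpa using hDf
  have hl : HasDerivAt (fun r : ℝ => (M x + r • M').det)
      (fderiv ℝ D (fun i j => M x i j) (fun i j => M' i j)) 0 :=
    hDf'.comp_hasDerivAt (0:ℝ) hL
  have hl2 : HasDerivAt (fun r : ℝ => (M x + r • M').det)
      ((M x).det * ((M x)⁻¹ * M').trace) 0 := by
    have e : ∀ r : ℝ, (M x + r • M').det = (M x).det * (1 + r • ((M x)⁻¹ * M')).det := by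
      intro r
      rw [← Matrix.det_mul, Matrix.mul_add, Matrix.mul_one, Matrix.mul_smul, ← Matrix.mul_assoc,
        Matrix.mul_nonsing_inv _ h0, Matrix.one_mul]
    have e2 := funext fun r => (e r).trans
      (congrArg ((M x).det * ·) (Matrix.det_one_add_smul r ((M x)⁻¹ * M')))
    rw [e2]
    refine HasDerivAt.const_mul _ ?_
    have h1 : HasDerivAt (fun r : ℝ => 1 + ((M x)⁻¹ * M').trace * r)
        (((M x)⁻¹ * M').trace * 1) 0 :=
      ((hasDerivAt_id (0:ℝ)).const_mul _).const_add 1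
    have h2 := (Polynomial.hasDerivAt (det (1 + (Polynomial.X : Polynomial ℝ) •
      ((M x)⁻¹ * M').map Polynomial.C)).divX.divX (0:ℝ)).fun_mul (hasDerivAt_pow 2 (0:ℝ))
    exact (h1.fun_add h2).congr_deriv (by simp)
  rw [hl2.unique hl]
  exact hc

/-! ### moment calculus -/

lemma sandwich (G : Matrix (Fin N) (Fin N) ℝ) (p u w q : Fin N → ℝ) :
    p ⬝ᵥ ((G * vecMulVec u w * G) *ᵥ q) = (p ⬝ᵥ (G *ᵥ u)) * (w ⬝ᵥ (G *ᵥ q)) := by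
  rw [← mulVec_mulVec, ← mulVec_mulVec, vecMulVec_mulVec]
  simp [mulVec_smul, mul_comm]

lemma bilin_hasDerivAt {x : ℝ} (p q : ℝ → Fin N → ℝ) (G : ℝ → Matrix (Fin N) (Fin N) ℝ)
    (p' q' : Fin N → ℝ) (G' : Matrix (Fin N) (Fin N) ℝ)
    (hp : ∀ i, HasDerivAt (fun s => p s i) (p' i) x)
    (hq : ∀ i, HasDerivAt (fun s => q s i) (q' i) x)
    (hG : ∀ i j, HasDerivAt (fun s => G s i j) (G' i j) x) :
    HasDerivAt (fun s => p s ⬝ᵥ (G s *ᵥ q s))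
      (p' ⬝ᵥ (G x *ᵥ q x) + p x ⬝ᵥ (G' *ᵥ q x) + p x ⬝ᵥ (G x *ᵥ q')) x := by
  simp only [dotProduct, mulVec]
  have := HasDerivAt.fun_sum (u := Finset.univ) fun i _ => (hp i).fun_mul
    (HasDerivAt.fun_sum (u := Finset.univ) fun j _ => (hG i j).fun_mul (hq j))
  refine this.congr_deriv ?_
  simp only [Finset.sum_add_distrib, mul_add]
  ring

lemma CN_symm (k γ : Fin N → ℝ) (t x : ℝ) : (1 + CN N k γ t x)ᵀ = 1 + CN N k γ t x := by
  ext i j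
  simp only [transpose_apply, Matrix.add_apply, CN_apply, Matrix.one_apply, eq_comm (a := i)]
  rw [add_comm (k j)]; ring

lemma mom_symm (k γ : Fin N → ℝ) (a b : ℕ) (t x : ℝ) :
    mom N k γ a b t x = mom N k γ b a t x := by
  unfold mom
  conv_lhs => rw [← CN_symm k γ t x, ← Matrix.transpose_nonsing_inv, Matrix.mulVec_transpose,
    dotProduct_comm, ← Matrix.dotProduct_mulVec]

lemma mom_hasDerivAt_x (k : Fin N → ℝ) (hk : ∀ i, 0 < k i) (γ : Fin N → ℝ) (a b : ℕ) (t x : ℝ) :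
    HasDerivAt (fun y => mom N k γ a b t y)
      (-mom N k γ (a+1) b t x - mom N k γ a (b+1) t x
        + mom N k γ a 0 t x * mom N k γ 0 b t x) x := by
  have hG := inv_hasDerivAt (fun y => 1 + CN N k γ t y) (Cx N k γ t x)
    (fun i j => CN_hasDerivAt_x k hk γ t x i j) (fun p => CN_isUnit k hk γ t p)
    (fun i j => by
      have h1 := (inv_contDiff k hk γ i j (n := 1)).differentiable (by norm_num)
      have h2 : DifferentiableAt ℝ (fun y : ℝ => ((t, y) : ℝ × ℝ)) x := by fun_prop
      exact (h1 (t, x)).comp x h2)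
  have := bilin_hasDerivAt _ _ _ (-(evec N k γ (a+1) t x)) (-(evec N k γ (b+1) t x)) _
    (fun i => evec_hasDerivAt_x k γ a t x i) (fun i => evec_hasDerivAt_x k γ b t x i) hG
  refine this.congr_deriv ?_
  simp only [Cx, Matrix.mul_neg, Matrix.neg_mul, neg_neg, sandwich, mulVec_neg,
    neg_dotProduct, dotProduct_neg, mom]
  ring

lemma mom_hasDerivAt_t (k : Fin N → ℝ) (hk : ∀ i, 0 < k i) (γ : Fin N → ℝ) (a b : ℕ) (t x : ℝ) :
    HasDerivAt (fun s => mom N k γ a b s x)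
      (4 * mom N k γ (a+3) b t x + 4 * mom N k γ a (b+3) t x
        - 4 * (mom N k γ a 2 t x * mom N k γ 0 b t x - mom N k γ a 1 t x * mom N k γ 1 b t x
          + mom N k γ a 0 t x * mom N k γ 2 b t x)) t := by
  have hG := inv_hasDerivAt (fun s => 1 + CN N k γ s x) (Ct N k γ t x)
    (fun i j => CN_hasDerivAt_t k hk γ t x i j) (fun p => CN_isUnit k hk γ p x)
    (fun i j => by
      have h1 := (inv_contDiff k hk γ i j (n := 1)).differentiable (by norm_num)
      have h2 : DifferentiableAt ℝ (fun y : ℝ => ((y, x) : ℝ × ℝ)) t := by fun_prop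
      exact (h1 (t, x)).comp t h2)
  have := bilin_hasDerivAt _ _ _ ((4:ℝ) • (evec N k γ (a+3) t x))
    ((4:ℝ) • (evec N k γ (b+3) t x)) _
    (fun i => evec_hasDerivAt_t k γ a t x i) (fun i => evec_hasDerivAt_t k γ b t x i) hG
  refine this.congr_deriv ?_
  simp only [Ct, Matrix.mul_smul, Matrix.smul_mul, Matrix.mul_add, Matrix.mul_sub,
    Matrix.add_mul, Matrix.sub_mul, neg_mulVec, smul_mulVec, add_mulVec, sub_mulVec,
    dotProduct_add, dotProduct_sub, sandwich, mulVec_smul, smul_dotProduct, dotProduct_smul,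
    smul_eq_mul, dotProduct_neg, mom]
  ring

lemma mom_rel (k : Fin N → ℝ) (hk : ∀ i, 0 < k i) (γ : Fin N → ℝ) (a b : ℕ) (t x : ℝ) :
    mom N k γ a (b+2) t x - mom N k γ (a+2) b t x
      = mom N k γ a 1 t x * mom N k γ 0 b t x - mom N k γ a 0 t x * mom N k γ 1 b t x := by
  set A := 1 + CN N k γ t x with hA
  set K : Matrix (Fin N) (Fin N) ℝ := Matrix.diagonal (fun i => k i ^ 2) with hK
  have hu : IsUnit A.det := CN_isUnit k hk γ t x
  have hcomm : K * A - A * K = vecMulVec (evec N k γ 1 t x) (evec N k γ 0 t x)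
      - vecMulVec (evec N k γ 0 t x) (evec N k γ 1 t x) := by
    rw [hA, Matrix.mul_add, Matrix.add_mul, Matrix.mul_one, Matrix.one_mul, add_sub_add_left_eq_sub]
    ext i j
    have hne : k i + k j ≠ 0 := (add_pos (hk i) (hk j)).ne'
    simp only [hK, Matrix.sub_apply, Matrix.diagonal_mul, Matrix.mul_diagonal, CN_apply,
      vecMulVec_apply]
    rw [evec_mul k γ 1 t x i, evec_mul k γ 1 t x j]
    field_simp
    ring
  have hGK : A⁻¹ * K - K * A⁻¹ = A⁻¹ * vecMulVec (evec N k γ 1 t x) (evec N k γ 0 t x) * A⁻¹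
      - A⁻¹ * vecMulVec (evec N k γ 0 t x) (evec N k γ 1 t x) * A⁻¹ := by
    rw [← Matrix.sub_mul, ← Matrix.mul_sub, ← hcomm, Matrix.mul_sub, Matrix.sub_mul,
      Matrix.mul_assoc, Matrix.mul_assoc, Matrix.mul_nonsing_inv _ hu, Matrix.mul_one,
      ← Matrix.mul_assoc, Matrix.nonsing_inv_mul _ hu, Matrix.one_mul]
  have hKe : ∀ c, K *ᵥ evec N k γ c t x = evec N k γ (c+2) t x := by
    intro c
    ext i
    simp only [hK, mulVec_diagonal, evec]
    ring
  have h := congrArg (fun Q => evec N k γ a t x ⬝ᵥ (Q *ᵥ evec N k γ b t x)) hGK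
  simp only [sub_mulVec, dotProduct_sub, sandwich] at h
  rw [← mulVec_mulVec, hKe, ← mulVec_mulVec, Matrix.dotProduct_mulVec _ K,
    ← Matrix.mulVec_transpose, show Kᵀ = K by simp [hK], hKe] at h
  exact h

/-! ### the explicit form of `phiN` -/

lemma logdet_hasDerivAt (k : Fin N → ℝ) (hk : ∀ i, 0 < k i) (γ : Fin N → ℝ) (t x : ℝ) :
    HasDerivAt (fun z => Real.log ((1 + CN N k γ t z).det)) (-mom N k γ 0 0 t x) x := by
  have h := det_hasDerivAt (fun y => 1 + CN N k γ t y) (Cx N k γ t x)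
    (fun i j => CN_hasDerivAt_x k hk γ t x i j) (CN_isUnit k hk γ t x)
  have hp := (CN_det_pos k hk γ t x).ne'
  refine (h.log hp).congr_deriv ?_
  rw [mul_div_cancel_left₀ _ hp]
  simp only [Cx, Matrix.mul_neg, Matrix.trace_neg, mul_vecMulVec, trace_vecMulVec, mom]
  rw [dotProduct_comm]

lemma phiN_eq (k : Fin N → ℝ) (hk : ∀ i, 0 < k i) (γ : Fin N → ℝ) (t x : ℝ) :
    phiN N k γ t x = 2 * mom N k γ 0 1 t x - mom N k γ 0 0 t x ^ 2 := by
  unfold phiN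
  have h1 : (fun y => deriv (fun z => Real.log ((1 + CN N k γ t z).det)) y)
      = fun y => -mom N k γ 0 0 t y :=
    funext fun y => (logdet_hasDerivAt k hk γ t y).deriv
  rw [h1, (mom_hasDerivAt_x k hk γ 0 0 t x).fun_neg.deriv, mom_symm k γ (0+1) 0]
  ring

lemma phiN_x (k : Fin N → ℝ) (hk : ∀ i, 0 < k i) (γ : Fin N → ℝ) (t x : ℝ) :
    HasDerivAt (fun y => phiN N k γ t y)
      (-2 * mom N k γ 1 1 t x - 2 * mom N k γ 0 2 t x + 6 * mom N k γ 0 0 t x * mom N k γ 0 1 t x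
        - 2 * mom N k γ 0 0 t x ^ 3) x := by
  simp only [phiN_eq k hk γ]
  have h00 := mom_hasDerivAt_x k hk γ 0 0 t x
  have h01 := mom_hasDerivAt_x k hk γ 0 1 t x
  refine ((h01.const_mul 2).fun_sub (h00.fun_pow 2)).congr_deriv ?_
  simp only [zero_add, Nat.reduceAdd, mom_symm k γ 1 0]
  push_cast
  ring

lemma phiN_xx (k : Fin N → ℝ) (hk : ∀ i, 0 < k i) (γ : Fin N → ℝ) (t x : ℝ) :
    HasDerivAt (fun y => deriv (fun w => phiN N k γ t w) y)
      (6 * mom N k γ 1 2 t x + 2 * mom N k γ 0 3 t x - 14 * mom N k γ 0 1 t x ^ 2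
        - 8 * mom N k γ 0 0 t x * mom N k γ 0 2 t x
        + 24 * mom N k γ 0 0 t x ^ 2 * mom N k γ 0 1 t x
        - 6 * mom N k γ 0 0 t x * mom N k γ 1 1 t x - 6 * mom N k γ 0 0 t x ^ 4) x := by
  simp only [fun y => (phiN_x k hk γ t y).deriv]
  have h00 := mom_hasDerivAt_x k hk γ 0 0 t x
  have h01 := mom_hasDerivAt_x k hk γ 0 1 t x
  have h11 := mom_hasDerivAt_x k hk γ 1 1 t x
  have h02 := mom_hasDerivAt_x k hk γ 0 2 t x
  refine ((((h11.const_mul (-2)).fun_sub (h02.const_mul 2)).fun_add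
    ((h00.const_mul 6).fun_mul h01)).fun_sub ((h00.fun_pow 3).const_mul 2)).congr_deriv ?_
  simp only [zero_add, Nat.reduceAdd, mom_symm k γ 1 0, mom_symm k γ 2 1]
  push_cast
  ring

lemma phiN_kdv (k : Fin N → ℝ) (hk : ∀ i, 0 < k i) (γ : Fin N → ℝ) (t x : ℝ) :
    deriv (fun s => phiN N k γ s x) t
        + deriv (fun y =>
            deriv (fun z => deriv (fun w => phiN N k γ t w) z) y
              + 6 * phiN N k γ t y ^ 2) x = 0 := by
  have hx3 := ((((((((mom_hasDerivAt_x k hk γ 1 2 t x).const_mul 6).fun_add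
    ((mom_hasDerivAt_x k hk γ 0 3 t x).const_mul 2)).fun_sub
    (((mom_hasDerivAt_x k hk γ 0 1 t x).fun_pow 2).const_mul 14)).fun_sub
    (((mom_hasDerivAt_x k hk γ 0 0 t x).const_mul 8).fun_mul
      (mom_hasDerivAt_x k hk γ 0 2 t x))).fun_add
    ((((mom_hasDerivAt_x k hk γ 0 0 t x).fun_pow 2).const_mul 24).fun_mul
      (mom_hasDerivAt_x k hk γ 0 1 t x))).fun_sub
    (((mom_hasDerivAt_x k hk γ 0 0 t x).const_mul 6).fun_mul
      (mom_hasDerivAt_x k hk γ 1 1 t x))).fun_sub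
    (((mom_hasDerivAt_x k hk γ 0 0 t x).fun_pow 4).const_mul 6)).fun_add
    (((phiN_x k hk γ t x).fun_pow 2).const_mul 6)
  have ht := ((mom_hasDerivAt_t k hk γ 0 1 t x).const_mul 2).fun_sub
    ((mom_hasDerivAt_t k hk γ 0 0 t x).fun_pow 2)
  simp only [fun y => (phiN_xx k hk γ t y).deriv]
  rw [hx3.deriv]
  have e : (fun s => phiN N k γ s x)
      = fun s => 2 * mom N k γ 0 1 s x - mom N k γ 0 0 s x ^ 2 :=
    funext fun s => phiN_eq k hk γ s x
  rw [e, ht.deriv, phiN_eq k hk γ t x]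
  have r01 := mom_rel k hk γ 0 1 t x
  have r02 := mom_rel k hk γ 0 2 t x
  simp only [zero_add, Nat.reduceAdd, mom_symm k γ 1 0, mom_symm k γ 2 1, mom_symm k γ 2 0,
    mom_symm k γ 3 0, mom_symm k γ 3 1] at r01 r02 ⊢
  push_cast
  linear_combination 6 * r02 - 6 * mom N k γ 0 0 t x * r01

end helpers

/-- `det(I + C_N) > 0` and `φ_N = ∂ₓ² log det(I + C_N)` is a
smooth classical solution of the KdV equation `∂_t u + ∂ₓ(∂ₓ² u + 6u²) = 0`. -/
theorem kdv_N_soliton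
    (N : ℕ) (hN : 0 < N) (k : Fin N → ℝ) (hk : ∀ i, 0 < k i)
    (hkm : StrictMono k) (γ : Fin N → ℝ) :
    (∀ t x : ℝ, 0 < (1 + CN N k γ t x).det) ∧
    ContDiff ℝ (⊤ : ℕ∞) (fun p : ℝ × ℝ => phiN N k γ p.1 p.2) ∧
    (∀ t x : ℝ,
      deriv (fun s => phiN N k γ s x) t
        + deriv (fun y =>
            deriv (fun z => deriv (fun w => phiN N k γ t w) z) y
              + 6 * phiN N k γ t y ^ 2) x = 0) := by
  refine ⟨fun t x => CN_det_pos k hk γ t x, ?_, fun t x => phiN_kdv k hk γ t x⟩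
  simp only [phiN_eq k hk γ]
  exact (contDiff_const.mul (mom_contDiff k hk γ 0 1)).sub ((mom_contDiff k hk γ 0 0).pow 2)
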